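/- arXiv:2406.20034 — 12 statements merged into one kernel-verified Lean document; each statement's English description precedes it below -/
import Mathlib

section
/- Let (A_i)_{i∈I} be a family of MLUB-complete posets. Then the cartesian product ∏_{i∈I} A_i (ordered componentwise) is an MLUB-complete poset, and for every nonempty subset M of the product, Min U(M) computed in the product equals the product over i ∈ I of Min U({m(i) : m ∈ M}) computed in A_i, and Max L(M) computed in the product equals the product over i ∈ I of Max L({m(i) : m ∈ M}) computed in A_i. -/
open Set

section Defs

variable {α T : Type*}

/-- The set of maximal elements of a subset of a poset. -/
def maxSet [PartialOrder α] (X : Set α) : Set α :=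
  {a | a ∈ X ∧ ∀ b ∈ X, a ≤ b → a = b}

/-- The set of minimal elements of a subset of a poset. -/
def minSet [PartialOrder α] (X : Set α) : Set α :=
  {a | a ∈ X ∧ ∀ b ∈ X, b ≤ a → a = b}

/-- MUB-complete: below every upper bound of a nonempty set there is a minimal upper bound. -/
def MUBComplete (α : Type*) [PartialOrder α] : Prop :=
  ∀ M : Set α, M.Nonempty → ∀ x ∈ upperBounds M, ∃ m ∈ minSet (upperBounds M), m ≤ x

/-- MLB-complete: above every lower bound of a nonempty set there is a maximal lower bound. -/
def MLBComplete (α : Type*) [PartialOrder α] : Prop :=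
  ∀ M : Set α, M.Nonempty → ∀ x ∈ lowerBounds M, ∃ m ∈ maxSet (lowerBounds M), x ≤ m

def MLUBComplete (α : Type*) [PartialOrder α] : Prop :=
  MUBComplete α ∧ MLBComplete α

/-- X ≤ Y : all-pairs comparison of subsets. -/
def leS [LE α] (X Y : Set α) : Prop := ∀ x ∈ X, ∀ y ∈ Y, x ≤ y

/-- X ≤₁ Y : every x ∈ X is below some y ∈ Y. -/
def le1 [LE α] (X Y : Set α) : Prop := ∀ x ∈ X, ∃ y ∈ Y, x ≤ y

/-- X ≤₂ Y : every y ∈ Y is above some x ∈ X. -/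
def le2 [LE α] (X Y : Set α) : Prop := ∀ y ∈ Y, ∃ x ∈ X, x ≤ y

/-- A binary relation is serial if every point has a predecessor and a successor. -/
def Serial (R : T → T → Prop) : Prop := ∀ s, (∃ r, R r s) ∧ (∃ t, R s t)

/-- B(s) = {q(s) : q ∈ B}. -/
def evalAt (s : T) (B : Set (T → α)) : Set α := (fun q => q s) '' B

/-- Tense operator P(B)(s) = Min U({q(t) : q ∈ B, t R s}). -/
def tP [PartialOrder α] (R : T → T → Prop) (B : Set (T → α)) (s : T) : Set α :=
  minSet (upperBounds {x | ∃ q ∈ B, ∃ t, R t s ∧ x = q t})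

/-- Tense operator F(B)(s) = Min U({q(t) : q ∈ B, s R t}). -/
def tF [PartialOrder α] (R : T → T → Prop) (B : Set (T → α)) (s : T) : Set α :=
  minSet (upperBounds {x | ∃ q ∈ B, ∃ t, R s t ∧ x = q t})

/-- Tense operator H(B)(s) = Max L({q(t) : q ∈ B, t R s}). -/
def tH [PartialOrder α] (R : T → T → Prop) (B : Set (T → α)) (s : T) : Set α :=
  maxSet (lowerBounds {x | ∃ q ∈ B, ∃ t, R t s ∧ x = q t})

/-- Tense operator G(B)(s) = Max L({q(t) : q ∈ B, s R t}). -/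
def tG [PartialOrder α] (R : T → T → Prop) (B : Set (T → α)) (s : T) : Set α :=
  maxSet (lowerBounds {x | ∃ q ∈ B, ∃ t, R s t ∧ x = q t})

/-- The transformation function φ. -/
def phi (B : T → Set α) : Set (T → α) := {q | ∀ t, q t ∈ B t}

end Defs

/-- Lemma 2.4: a product of MLUB-complete posets is MLUB-complete, and
Min U and Max L are computed componentwise. -/
theorem stmt1 {I : Type*} {α : I → Type*} [∀ i, PartialOrder (α i)]
    (h : ∀ i, MLUBComplete (α i)) :
    MLUBComplete (∀ i, α i) ∧
    ∀ M : Set (∀ i, α i), M.Nonempty →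
      minSet (upperBounds M) =
        {f | ∀ i, f i ∈ minSet (upperBounds ((fun m => m i) '' M))} ∧
      maxSet (lowerBounds M) =
        {f | ∀ i, f i ∈ maxSet (lowerBounds ((fun m => m i) '' M))} := by
  have hU : ∀ (M : Set (∀ i, α i)) (f : ∀ i, α i),
      f ∈ upperBounds M ↔ ∀ i, f i ∈ upperBounds ((fun m => m i) '' M) := by
    intro M f
    constructor
    · rintro hf i _ ⟨m, hm, rfl⟩
      exact hf hm i
    · intro hf m hm i
      exact hf i ⟨m, hm, rfl⟩
  have hL : ∀ (M : Set (∀ i, α i)) (f : ∀ i, α i),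
      f ∈ lowerBounds M ↔ ∀ i, f i ∈ lowerBounds ((fun m => m i) '' M) := by
    intro M f
    constructor
    · rintro hf i _ ⟨m, hm, rfl⟩
      exact hf hm i
    · intro hf m hm i
      exact hf i ⟨m, hm, rfl⟩
  have hmin : ∀ M : Set (∀ i, α i), minSet (upperBounds M) =
        {f | ∀ i, f i ∈ minSet (upperBounds ((fun m => m i) '' M))} := by
    classical
    intro M
    ext f
    constructor
    · rintro ⟨h1, h2⟩ i
      refine ⟨(hU M f).1 h1 i, fun b hb hbf => ?_⟩
      have := h2 (Function.update f i b) ((hU M _).2 ?_) ?_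
      · simpa using congrFun this i
      · intro j
        by_cases hj : j = i
        · subst hj
          simpa only [Function.update_self] using hb
        · rw [Function.update_of_ne hj]
          exact (hU M f).1 h1 j
      · exact update_le_self_iff.2 hbf
    · intro hf
      refine ⟨(hU M f).2 fun i => (hf i).1, fun b hb hbf => ?_⟩
      funext i
      exact (hf i).2 _ ((hU M b).1 hb i) (hbf i)
  have hmax : ∀ M : Set (∀ i, α i), maxSet (lowerBounds M) =
        {f | ∀ i, f i ∈ maxSet (lowerBounds ((fun m => m i) '' M))} := by
    classical
    intro M
    ext f
    constructor
    · rintro ⟨h1, h2⟩ i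
      refine ⟨(hL M f).1 h1 i, fun b hb hbf => ?_⟩
      have := h2 (Function.update f i b) ((hL M _).2 ?_) ?_
      · simpa using congrFun this i
      · intro j
        by_cases hj : j = i
        · subst hj
          simpa only [Function.update_self] using hb
        · rw [Function.update_of_ne hj]
          exact (hL M f).1 h1 j
      · exact le_update_self_iff.2 hbf
    · intro hf
      refine ⟨(hL M f).2 fun i => (hf i).1, fun b hb hbf => ?_⟩
      funext i
      exact (hf i).2 _ ((hL M b).1 hb i) (hbf i)
  refine ⟨⟨?_, ?_⟩, fun M _ => ⟨hmin M, hmax M⟩⟩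
  · intro M hM x hx
    choose g hg hgx using fun i => (h i).1 _ (hM.image (fun m => m i)) (x i) ((hU M x).1 hx i)
    exact ⟨g, by rw [hmin M]; exact hg, hgx⟩
  · intro M hM x hx
    choose g hg hgx using fun i => (h i).2 _ (hM.image (fun m => m i)) (x i) ((hL M x).1 hx i)
    exact ⟨g, by rw [hmax M]; exact hg, hgx⟩
end

section
/- Let A be an MLUB-complete bounded poset, (T,R) a time frame, and B a nonempty subset of A^T. Then, as functions of s ∈ T, P(L(B)) = P(Max L(B)), F(L(B)) = F(Max L(B)), H(U(B)) = H(Min U(B)) and G(U(B)) = G(Min U(B)), where the cones L(B), U(B) and the sets Max L(B), Min U(B) are computed in the pointwise-ordered poset A^T. -/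
open Set

theorem exMax {α T : Type*} [PartialOrder α] (h : MLBComplete α)
    (B : Set (T → α)) (hB : B.Nonempty) (q : T → α) (hq : q ∈ lowerBounds B) :
    ∃ m ∈ maxSet (lowerBounds B), q ≤ m := by
  have key : ∀ t, ∃ m ∈ maxSet (lowerBounds (evalAt t B)), q t ≤ m := by
    intro t
    apply h _ (hB.image _)
    rintro _ ⟨p, hp, rfl⟩
    exact hq hp t
  choose m hm hqm using key
  refine ⟨m, ⟨fun p hp t => (hm t).1 ⟨p, hp, rfl⟩, fun b hb hmb => ?_⟩, hqm⟩
  funext t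
  refine (hm t).2 (b t) ?_ (hmb t)
  rintro _ ⟨p, hp, rfl⟩
  exact hb hp t

theorem exMin {α T : Type*} [PartialOrder α] (h : MUBComplete α)
    (B : Set (T → α)) (hB : B.Nonempty) (q : T → α) (hq : q ∈ upperBounds B) :
    ∃ m ∈ minSet (upperBounds B), m ≤ q := by
  have key : ∀ t, ∃ m ∈ minSet (upperBounds (evalAt t B)), m ≤ q t := by
    intro t
    apply h _ (hB.image _)
    rintro _ ⟨p, hp, rfl⟩
    exact hq hp t
  choose m hm hqm using key
  refine ⟨m, ⟨fun p hp t => (hm t).1 ⟨p, hp, rfl⟩, fun b hb hmb => ?_⟩, hqm⟩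
  funext t
  refine (hm t).2 (b t) ?_ (hmb t)
  rintro _ ⟨p, hp, rfl⟩
  exact hb hp t

theorem ubEq {α T : Type*} [PartialOrder α] (h : MLBComplete α)
    (B : Set (T → α)) (hB : B.Nonempty) (S : T → Prop) :
    upperBounds {x | ∃ q ∈ lowerBounds B, ∃ t, S t ∧ x = q t} =
    upperBounds {x | ∃ q ∈ maxSet (lowerBounds B), ∃ t, S t ∧ x = q t} := by
  ext a
  constructor
  · rintro ha _ ⟨q, hq, t, ht, rfl⟩
    exact ha ⟨q, hq.1, t, ht, rfl⟩
  · rintro ha _ ⟨q, hq, t, ht, rfl⟩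
    obtain ⟨m, hm, hqm⟩ := exMax h B hB q hq
    exact (hqm t).trans (ha ⟨m, hm, t, ht, rfl⟩)

theorem lbEq {α T : Type*} [PartialOrder α] (h : MUBComplete α)
    (B : Set (T → α)) (hB : B.Nonempty) (S : T → Prop) :
    lowerBounds {x | ∃ q ∈ upperBounds B, ∃ t, S t ∧ x = q t} =
    lowerBounds {x | ∃ q ∈ minSet (upperBounds B), ∃ t, S t ∧ x = q t} := by
  ext a
  constructor
  · rintro ha _ ⟨q, hq, t, ht, rfl⟩
    exact ha ⟨q, hq.1, t, ht, rfl⟩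
  · rintro ha _ ⟨q, hq, t, ht, rfl⟩
    obtain ⟨m, hm, hqm⟩ := exMin h B hB q hq
    exact (ha ⟨m, hm, t, ht, rfl⟩).trans (hqm t)

/-- Lemma 3.3: P(L(B)) = P(Max L(B)), F(L(B)) = F(Max L(B)),
H(U(B)) = H(Min U(B)), G(U(B)) = G(Min U(B)), cones taken in A^T. -/
theorem stmt2 {α T : Type*} [PartialOrder α] [BoundedOrder α] [Nonempty T]
    (h : MLUBComplete α) (R : T → T → Prop)
    (B : Set (T → α)) (hB : B.Nonempty) :
    tP R (lowerBounds B) = tP R (maxSet (lowerBounds B)) ∧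
    tF R (lowerBounds B) = tF R (maxSet (lowerBounds B)) ∧
    tH R (upperBounds B) = tH R (minSet (upperBounds B)) ∧
    tG R (upperBounds B) = tG R (minSet (upperBounds B)) := by
  refine ⟨?_, ?_, ?_, ?_⟩ <;> funext s
  · exact congrArg minSet (ubEq h.2 B hB (fun t => R t s))
  · exact congrArg minSet (ubEq h.2 B hB (fun t => R s t))
  · exact congrArg maxSet (lbEq h.1 B hB (fun t => R t s))
  · exact congrArg maxSet (lbEq h.1 B hB (fun t => R s t))
end

section
/- Let A be an MLUB-complete poset, (T,R) a time frame, and B : T → 𝒫₊(A) a family of nonempty subsets of A. Then for all s ∈ T: P(φ(B))(s) = Min U(⋃{B(t) : t R s}), F(φ(B))(s) = Min U(⋃{B(t) : s R t}), H(φ(B))(s) = Max L(⋃{B(t) : t R s}), and G(φ(B))(s) = Max L(⋃{B(t) : s R t}). -/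
open Set

theorem phi_values_eq {α T : Type*} (B : T → Set α) (hB : ∀ t, (B t).Nonempty) (p : T → Prop) :
    {x | ∃ q ∈ phi B, ∃ t, p t ∧ x = q t} = ⋃ t ∈ {t | p t}, B t := by
  classical
  ext x
  simp only [Set.mem_iUnion, Set.mem_setOf_eq, exists_prop]
  constructor
  · rintro ⟨q, hq, t, ht, rfl⟩
    exact ⟨t, ht, hq t⟩
  · rintro ⟨t, ht, hx⟩
    choose f hf using hB
    refine ⟨Function.update f t x, ?_, t, ht, by simp⟩
    intro u
    by_cases hu : u = t
    · subst hu
      simpa using hx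
    · simpa [Function.update_of_ne hu] using hf u

/-- Theorem 3.9: values of the tense operators on φ(B). -/
theorem stmt5 {α T : Type*} [PartialOrder α] [Nonempty T]
    (h : MLUBComplete α) (R : T → T → Prop)
    (B : T → Set α) (hB : ∀ t, (B t).Nonempty) (s : T) :
    tP R (phi B) s = minSet (upperBounds (⋃ t ∈ {t | R t s}, B t)) ∧
    tF R (phi B) s = minSet (upperBounds (⋃ t ∈ {t | R s t}, B t)) ∧
    tH R (phi B) s = maxSet (lowerBounds (⋃ t ∈ {t | R t s}, B t)) ∧
    tG R (phi B) s = maxSet (lowerBounds (⋃ t ∈ {t | R s t}, B t)) := by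
  refine ⟨?_, ?_, ?_, ?_⟩
  · rw [tP, phi_values_eq B hB (fun t => R t s)]
  · rw [tF, phi_values_eq B hB (fun t => R s t)]
  · rw [tH, phi_values_eq B hB (fun t => R t s)]
  · rw [tG, phi_values_eq B hB (fun t => R s t)]
end

section
/- Let A be an MLUB-complete poset, (T,R) a time frame, and C, D nonempty subsets of A^T. If C ≤₁ D (in particular, if C ⊆ D), then for all s ∈ T: P(C)(s) ≤₂ P(D)(s), L(P(C)(s)) ⊆ L(P(D)(s)), F(C)(s) ≤₂ F(D)(s) and L(F(C)(s)) ⊆ L(F(D)(s)). Dually, if C ≤₂ D (in particular, if D ⊆ C), then for all s ∈ T: H(C)(s) ≤₁ H(D)(s), U(H(D)(s)) ⊆ U(H(C)(s)), G(C)(s) ≤₁ G(D)(s) and U(G(D)(s)) ⊆ U(G(C)(s)). -/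
open Set

theorem aux_min {α T : Type*} [PartialOrder α] (h : MUBComplete α) (r : T → Prop)
    (C D : Set (T → α)) (hC : C.Nonempty) (hCD : le1 C D) :
    le2 (minSet (upperBounds {x | ∃ q ∈ C, ∃ t, r t ∧ x = q t}))
      (minSet (upperBounds {x | ∃ q ∈ D, ∃ t, r t ∧ x = q t})) := by
  intro y hy
  by_cases hr : ∃ t, r t
  · obtain ⟨t, ht⟩ := hr
    obtain ⟨q, hq⟩ := hC
    refine h {x | ∃ q ∈ C, ∃ t, r t ∧ x = q t} ⟨q t, q, hq, t, ht, rfl⟩ y ?_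
    rintro _ ⟨p, hp, u, hu, rfl⟩
    obtain ⟨d, hd, hpd⟩ := hCD p hp
    exact (hpd u).trans (hy.1 ⟨d, hd, u, hu, rfl⟩)
  · have e : ∀ B : Set (T → α), {x | ∃ q ∈ B, ∃ t, r t ∧ x = q t} = (∅ : Set α) := by
      intro B
      ext x
      simp only [Set.mem_ofPred_eq, Set.mem_empty_iff_false, iff_false]
      rintro ⟨q, _, t, ht, _⟩
      exact hr ⟨t, ht⟩
    rw [e] at hy ⊢
    exact ⟨y, hy, le_rfl⟩

theorem aux_max {α T : Type*} [PartialOrder α] (h : MLBComplete α) (r : T → Prop)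
    (C D : Set (T → α)) (hD : D.Nonempty) (hCD : le2 C D) :
    le1 (maxSet (lowerBounds {x | ∃ q ∈ C, ∃ t, r t ∧ x = q t}))
      (maxSet (lowerBounds {x | ∃ q ∈ D, ∃ t, r t ∧ x = q t})) := by
  intro y hy
  by_cases hr : ∃ t, r t
  · obtain ⟨t, ht⟩ := hr
    obtain ⟨q, hq⟩ := hD
    refine h {x | ∃ q ∈ D, ∃ t, r t ∧ x = q t} ⟨q t, q, hq, t, ht, rfl⟩ y ?_
    rintro _ ⟨p, hp, u, hu, rfl⟩
    obtain ⟨d, hd, hpd⟩ := hCD p hp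
    exact (hy.1 ⟨d, hd, u, hu, rfl⟩).trans (hpd u)
  · have e : ∀ B : Set (T → α), {x | ∃ q ∈ B, ∃ t, r t ∧ x = q t} = (∅ : Set α) := by
      intro B
      ext x
      simp only [Set.mem_ofPred_eq, Set.mem_empty_iff_false, iff_false]
      rintro ⟨q, _, t, ht, _⟩
      exact hr ⟨t, ht⟩
    rw [e] at hy ⊢
    exact ⟨y, hy, le_rfl⟩

theorem aux_lb {α : Type*} [PartialOrder α] {X Y : Set α} (h : le2 X Y) :
    lowerBounds X ⊆ lowerBounds Y := by
  intro a ha y hy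
  obtain ⟨x, hx, hxy⟩ := h y hy
  exact (ha hx).trans hxy

theorem aux_ub {α : Type*} [PartialOrder α] {X Y : Set α} (h : le1 X Y) :
    upperBounds Y ⊆ upperBounds X := by
  intro a ha x hx
  obtain ⟨y, hy, hxy⟩ := h x hx
  exact hxy.trans (ha hy)

/-- Theorem 3.10 (i),(ii): monotonicity properties of the tense operators. -/
theorem stmt6 {α T : Type*} [PartialOrder α] [Nonempty T]
    (h : MLUBComplete α) (R : T → T → Prop)
    (C D : Set (T → α)) (hC : C.Nonempty) (hD : D.Nonempty) :
    ((C ⊆ D ∨ le1 C D) →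
      ∀ s, le2 (tP R C s) (tP R D s) ∧
        lowerBounds (tP R C s) ⊆ lowerBounds (tP R D s) ∧
        le2 (tF R C s) (tF R D s) ∧
        lowerBounds (tF R C s) ⊆ lowerBounds (tF R D s)) ∧
    ((D ⊆ C ∨ le2 C D) →
      ∀ s, le1 (tH R C s) (tH R D s) ∧
        upperBounds (tH R D s) ⊆ upperBounds (tH R C s) ∧
        le1 (tG R C s) (tG R D s) ∧
        upperBounds (tG R D s) ⊆ upperBounds (tG R C s)) := by
  constructor
  · intro hCD s
    have h1 : le1 C D := hCD.elim (fun k x hx => ⟨x, k hx, le_rfl⟩) id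
    have hP : le2 (tP R C s) (tP R D s) := aux_min h.1 (fun t => R t s) C D hC h1
    have hF : le2 (tF R C s) (tF R D s) := aux_min h.1 (fun t => R s t) C D hC h1
    exact ⟨hP, aux_lb hP, hF, aux_lb hF⟩
  · intro hCD s
    have h1 : le2 C D := hCD.elim (fun k x hx => ⟨x, k hx, le_rfl⟩) id
    have hH : le1 (tH R C s) (tH R D s) := aux_max h.2 (fun t => R t s) C D hD h1
    have hG : le1 (tG R C s) (tG R D s) := aux_max h.2 (fun t => R s t) C D hD h1
    exact ⟨hH, aux_ub hH, hG, aux_ub hG⟩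
end

section
/- Let A be an MLUB-complete bounded poset and (T,R) a time frame with R reflexive, and let P, F, H, G be the tense operators induced by (T,R). Then, pointwise at every nonempty B ⊆ A^T and every s ∈ T: P(B)(s) ≤₂ (P*F)(B)(s), F(B)(s) ≤₂ (F*P)(B)(s), H(B)(s) ≤₁ (H*P)(B)(s), G(B)(s) ≤₁ (G*P)(B)(s), (P*H)(B)(s) ≤₂ P(B)(s), (F*H)(B)(s) ≤₂ F(B)(s), H(B)(s) ≤₁ (H*F)(B)(s), G(B)(s) ≤₁ (G*F)(B)(s), (P*G)(B)(s) ≤₂ P(B)(s), (F*G)(B)(s) ≤₂ F(B)(s), (H*G)(B)(s) ≤₁ H(B)(s), and (G*H)(B)(s) ≤₁ G(B)(s). -/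
open Set

theorem aux_le {α T : Type*} [PartialOrder α] (h : MLUBComplete α) (S : T → Prop) (s : T)
    (hs : S s) (B C : Set (T → α)) (hB : B.Nonempty) (hC : C.Nonempty)
    (hBC : ∀ b ∈ B, ∀ c ∈ C, ∀ t, b t ≤ c t) :
    le2 (minSet (upperBounds {x | ∃ q ∈ B, ∃ t, S t ∧ x = q t}))
      (minSet (upperBounds {x | ∃ q ∈ C, ∃ t, S t ∧ x = q t})) ∧
    le1 (maxSet (lowerBounds {x | ∃ q ∈ B, ∃ t, S t ∧ x = q t}))
      (maxSet (lowerBounds {x | ∃ q ∈ C, ∃ t, S t ∧ x = q t})) := by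
  obtain ⟨b, hb⟩ := hB
  obtain ⟨c, hc⟩ := hC
  constructor
  · intro y hy
    refine h.1 {x | ∃ q ∈ B, ∃ t, S t ∧ x = q t} ⟨b s, b, hb, s, hs, rfl⟩ y ?_
    rintro _ ⟨q, hq, t, ht, rfl⟩
    exact (hBC q hq c hc t).trans (hy.1 ⟨c, hc, t, ht, rfl⟩)
  · intro y hy
    refine h.2 {x | ∃ q ∈ C, ∃ t, S t ∧ x = q t} ⟨c s, c, hc, s, hs, rfl⟩ y ?_
    rintro _ ⟨q, hq, t, ht, rfl⟩
    exact (hy.1 ⟨b, hb, t, ht, rfl⟩ : y ≤ b t).trans (hBC b hb q hq t)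

theorem phi_ne {α T : Type*} (D : T → Set α) (hD : ∀ t, ∃ x, x ∈ D t) : (phi D).Nonempty := by
  choose f hf using hD
  exact ⟨f, hf⟩

/-- Theorem 3.12: inequalities between tense operators and their compositions
X*Y = X ∘ φ ∘ Y, with R reflexive. -/
theorem stmt10 {α T : Type*} [PartialOrder α] [BoundedOrder α] [Nonempty T]
    (h : MLUBComplete α) (R : T → T → Prop) (hR : Reflexive R)
    (B : Set (T → α)) (hB : B.Nonempty) (s : T) :
    le2 (tP R B s) (tP R (phi (tF R B)) s) ∧
    le2 (tF R B s) (tF R (phi (tP R B)) s) ∧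
    le1 (tH R B s) (tH R (phi (tP R B)) s) ∧
    le1 (tG R B s) (tG R (phi (tP R B)) s) ∧
    le2 (tP R (phi (tH R B)) s) (tP R B s) ∧
    le2 (tF R (phi (tH R B)) s) (tF R B s) ∧
    le1 (tH R B s) (tH R (phi (tF R B)) s) ∧
    le1 (tG R B s) (tG R (phi (tF R B)) s) ∧
    le2 (tP R (phi (tG R B)) s) (tP R B s) ∧
    le2 (tF R (phi (tG R B)) s) (tF R B s) ∧
    le1 (tH R (phi (tG R B)) s) (tH R B s) ∧
    le1 (tG R (phi (tH R B)) s) (tG R B s) := by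
  obtain ⟨b, hb⟩ := id hB
  have nP : (phi (tP R B)).Nonempty := phi_ne _ fun t => by
    obtain ⟨m, hm, -⟩ := h.1 {x | ∃ q ∈ B, ∃ u, R u t ∧ x = q u}
      ⟨b t, b, hb, t, hR t, rfl⟩ ⊤ (fun _ _ => le_top)
    exact ⟨m, hm⟩
  have nF : (phi (tF R B)).Nonempty := phi_ne _ fun t => by
    obtain ⟨m, hm, -⟩ := h.1 {x | ∃ q ∈ B, ∃ u, R t u ∧ x = q u}
      ⟨b t, b, hb, t, hR t, rfl⟩ ⊤ (fun _ _ => le_top)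
    exact ⟨m, hm⟩
  have nH : (phi (tH R B)).Nonempty := phi_ne _ fun t => by
    obtain ⟨m, hm, -⟩ := h.2 {x | ∃ q ∈ B, ∃ u, R u t ∧ x = q u}
      ⟨b t, b, hb, t, hR t, rfl⟩ ⊥ (fun _ _ => bot_le)
    exact ⟨m, hm⟩
  have nG : (phi (tG R B)).Nonempty := phi_ne _ fun t => by
    obtain ⟨m, hm, -⟩ := h.2 {x | ∃ q ∈ B, ∃ u, R t u ∧ x = q u}
      ⟨b t, b, hb, t, hR t, rfl⟩ ⊥ (fun _ _ => bot_le)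
    exact ⟨m, hm⟩
  have lP : ∀ b ∈ B, ∀ c ∈ phi (tP R B), ∀ t, b t ≤ c t :=
    fun b hb c hc t => (hc t).1 ⟨b, hb, t, hR t, rfl⟩
  have lF : ∀ b ∈ B, ∀ c ∈ phi (tF R B), ∀ t, b t ≤ c t :=
    fun b hb c hc t => (hc t).1 ⟨b, hb, t, hR t, rfl⟩
  have lH : ∀ c ∈ phi (tH R B), ∀ b ∈ B, ∀ t, c t ≤ b t :=
    fun c hc b hb t => (hc t).1 ⟨b, hb, t, hR t, rfl⟩
  have lG : ∀ c ∈ phi (tG R B), ∀ b ∈ B, ∀ t, c t ≤ b t :=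
    fun c hc b hb t => (hc t).1 ⟨b, hb, t, hR t, rfl⟩
  have pst := aux_le h (fun t => R t s) s (hR s)
  have fut := aux_le h (fun t => R s t) s (hR s)
  exact ⟨(pst _ _ hB nF lF).1, (fut _ _ hB nP lP).1, (pst _ _ hB nP lP).2, (fut _ _ hB nP lP).2,
    (pst _ _ nH hB lH).1, (fut _ _ nH hB lH).1, (pst _ _ hB nF lF).2, (fut _ _ hB nF lF).2,
    (pst _ _ nG hB lG).1, (fut _ _ nG hB lG).1, (pst _ _ nG hB lG).2, (fut _ _ nH hB lH).2⟩
end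

section
/- Let A be an MLUB-complete bounded poset, (T,R) a time frame with R reflexive, and X any map sending each nonempty B ⊆ A^T to a family X(B) : T → 𝒫₊(A) of nonempty subsets of A. Then for every nonempty B ⊆ A^T and every s ∈ T: (H*X)(B)(s) ≤ X(B)(s) ≤ (P*X)(B)(s) and (G*X)(B)(s) ≤ X(B)(s) ≤ (F*X)(B)(s), where for subsets X, Y of A, X ≤ Y means x ≤ y for all x ∈ X and y ∈ Y. In particular, P(B)(s) ≤ (P*P)(B)(s), F(B)(s) ≤ (F*F)(B)(s), (H*H)(B)(s) ≤ H(B)(s) and (G*G)(B)(s) ≤ G(B)(s). -/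
open Set

theorem exists_phi_aux {α T : Type*} (Y : T → Set α) (hY : ∀ t, (Y t).Nonempty) (s : T)
    (x : α) (hx : x ∈ Y s) : ∃ q ∈ phi Y, x = q s := by
  classical
  choose f hf using hY
  refine ⟨Function.update f s x, ?_, by simp⟩
  intro t
  by_cases hts : t = s
  · subst hts
    simpa using hx
  · simpa [Function.update_of_ne hts] using hf t

/-- Theorem 3.13: H*X, G*X ≤ X ≤ P*X, F*X for any operator X, and in
particular P ≤ P*P, F ≤ F*F, H*H ≤ H, G*G ≤ G (all pointwise, all-pairs). -/
theorem stmt11 {α T : Type*} [PartialOrder α] [BoundedOrder α] [Nonempty T]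
    (h : MLUBComplete α) (R : T → T → Prop) (hR : Reflexive R)
    (X : Set (T → α) → T → Set α)
    (hX : ∀ B : Set (T → α), B.Nonempty → ∀ t, (X B t).Nonempty)
    (B : Set (T → α)) (hB : B.Nonempty) (s : T) :
    (leS (tH R (phi (X B)) s) (X B s) ∧
     leS (tG R (phi (X B)) s) (X B s) ∧
     leS (X B s) (tP R (phi (X B)) s) ∧
     leS (X B s) (tF R (phi (X B)) s)) ∧
    (leS (tP R B s) (tP R (phi (tP R B)) s) ∧
     leS (tF R B s) (tF R (phi (tF R B)) s) ∧
     leS (tH R (phi (tH R B)) s) (tH R B s) ∧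
     leS (tG R (phi (tG R B)) s) (tG R B s)) := by
  have low : ∀ Y : T → Set α, (∀ t, (Y t).Nonempty) →
      leS (tH R (phi Y) s) (Y s) ∧ leS (tG R (phi Y) s) (Y s) ∧
      leS (Y s) (tP R (phi Y) s) ∧ leS (Y s) (tF R (phi Y) s) := by
    intro Y hY
    refine ⟨?_, ?_, ?_, ?_⟩
    · intro x hx y hy
      obtain ⟨q, hq, e⟩ := exists_phi_aux Y hY s y hy
      exact hx.1 ⟨q, hq, s, hR s, e⟩
    · intro x hx y hy
      obtain ⟨q, hq, e⟩ := exists_phi_aux Y hY s y hy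
      exact hx.1 ⟨q, hq, s, hR s, e⟩
    · intro x hx y hy
      obtain ⟨q, hq, e⟩ := exists_phi_aux Y hY s x hx
      exact hy.1 ⟨q, hq, s, hR s, e⟩
    · intro x hx y hy
      obtain ⟨q, hq, e⟩ := exists_phi_aux Y hY s x hx
      exact hy.1 ⟨q, hq, s, hR s, e⟩
  obtain ⟨q, hq⟩ := hB
  have nP : ∀ t, (tP R B t).Nonempty := fun t => by
    obtain ⟨m, hm, _⟩ := h.1 {x | ∃ q ∈ B, ∃ u, R u t ∧ x = q u} ⟨q t, q, hq, t, hR t, rfl⟩ ⊤ (fun _ _ => le_top)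
    exact ⟨m, hm⟩
  have nF : ∀ t, (tF R B t).Nonempty := fun t => by
    obtain ⟨m, hm, _⟩ := h.1 {x | ∃ q ∈ B, ∃ u, R t u ∧ x = q u} ⟨q t, q, hq, t, hR t, rfl⟩ ⊤ (fun _ _ => le_top)
    exact ⟨m, hm⟩
  have nH : ∀ t, (tH R B t).Nonempty := fun t => by
    obtain ⟨m, hm, _⟩ := h.2 {x | ∃ q ∈ B, ∃ u, R u t ∧ x = q u} ⟨q t, q, hq, t, hR t, rfl⟩ ⊥ (fun _ _ => bot_le)
    exact ⟨m, hm⟩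
  have nG : ∀ t, (tG R B t).Nonempty := fun t => by
    obtain ⟨m, hm, _⟩ := h.2 {x | ∃ q ∈ B, ∃ u, R t u ∧ x = q u} ⟨q t, q, hq, t, hR t, rfl⟩ ⊥ (fun _ _ => bot_le)
    exact ⟨m, hm⟩
  exact ⟨low _ (hX B ⟨q, hq⟩), (low _ nP).2.2.1, (low _ nF).2.2.2, (low _ nH).1, (low _ nG).2.1⟩
end

section
/- Let A be a bounded poset, T a nonempty set, and P, G maps sending each nonempty subset of A^T to a family T → 𝒫₊(A) of nonempty subsets of A. Then the following are equivalent: (1) P and G form a Galois connection, i.e. for all nonempty C, D ⊆ A^T: P(C) ≤₂ D if and only if C ≤₁ G(D) (both relations taken pointwise, via D(s) = {q(s) : q ∈ D} and C(s) = {q(s) : q ∈ C}); (2) P and G satisfy (T1): for all nonempty C, D ⊆ A^T, C ≤₁ D implies P(C) ≤₂ P(D) and C ≤₂ D implies G(C) ≤₁ G(D); and (T2): for every nonempty C ⊆ A^T, C ≤₁ (G*P)(C) and (P*G)(C) ≤₂ C. -/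
open Set

/-- Theorem 3.17: P,G form a Galois connection iff they satisfy (T1) and (T2). -/
theorem stmt12 {α T : Type*} [PartialOrder α] [BoundedOrder α] [Nonempty T]
    (P G : Set (T → α) → T → Set α)
    (hP : ∀ B : Set (T → α), B.Nonempty → ∀ t, (P B t).Nonempty)
    (hG : ∀ B : Set (T → α), B.Nonempty → ∀ t, (G B t).Nonempty) :
    (∀ C D : Set (T → α), C.Nonempty → D.Nonempty →
        ((∀ s, le2 (P C s) (evalAt s D)) ↔ (∀ s, le1 (evalAt s C) (G D s)))) ↔
    ((∀ C D : Set (T → α), C.Nonempty → D.Nonempty →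
        (le1 C D → ∀ s, le2 (P C s) (P D s)) ∧
        (le2 C D → ∀ s, le1 (G C s) (G D s))) ∧
     (∀ C : Set (T → α), C.Nonempty →
        (∀ s, le1 (evalAt s C) (G (phi (P C)) s)) ∧
        (∀ s, le2 (P (phi (G C)) s) (evalAt s C)))) := by
  have key : ∀ B : T → Set α, (∀ t, (B t).Nonempty) → ∀ s, evalAt s (phi B) = B s := by
    intro B hB s
    classical
    choose f hf using hB
    ext x
    constructor
    · rintro ⟨q, hq, rfl⟩
      exact hq s
    · intro hx
      refine ⟨Function.update f s x, ?_, by simp⟩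
      intro t
      by_cases h : t = s
      · subst h
        simpa using hx
      · simpa [Function.update_of_ne h] using hf t
  have ne : ∀ B : T → Set α, (∀ t, (B t).Nonempty) → (phi B).Nonempty := by
    intro B hB
    choose f hf using hB
    exact ⟨f, hf⟩
  constructor
  · intro h
    have t1 : ∀ C : Set (T → α), C.Nonempty → ∀ s, le1 (evalAt s C) (G (phi (P C)) s) := by
      intro C hC
      refine (h C _ hC (ne _ (hP C hC))).1 ?_
      intro s
      rw [key _ (hP C hC)]
      exact fun y hy => ⟨y, hy, le_rfl⟩
    have t2 : ∀ C : Set (T → α), C.Nonempty → ∀ s, le2 (P (phi (G C)) s) (evalAt s C) := by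
      intro C hC
      refine (h _ C (ne _ (hG C hC)) hC).2 ?_
      intro s
      rw [key _ (hG C hC)]
      exact fun y hy => ⟨y, hy, le_rfl⟩
    refine ⟨fun C D hC hD => ⟨fun hCD => ?_, fun hCD => ?_⟩, fun C hC => ⟨t1 C hC, t2 C hC⟩⟩
    · have := (h C _ hC (ne _ (hP D hD))).2 (by
        rintro s _ ⟨q, hq, rfl⟩
        obtain ⟨r, hr, hqr⟩ := hCD q hq
        obtain ⟨y, hy, hy2⟩ := t1 D hD s (r s) ⟨r, hr, rfl⟩
        exact ⟨y, hy, (hqr s).trans hy2⟩)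
      intro s
      have h2 := this s
      rwa [key _ (hP D hD)] at h2
    · have := (h _ D (ne _ (hG C hC)) hD).1 (by
        rintro s _ ⟨q, hq, rfl⟩
        obtain ⟨r, hr, hqr⟩ := hCD q hq
        obtain ⟨y, hy, hy2⟩ := t2 C hC s (r s) ⟨r, hr, rfl⟩
        exact ⟨y, hy, hy2.trans (hqr s)⟩)
      intro s
      have h2 := this s
      rwa [key _ (hG C hC)] at h2
  · rintro ⟨h1, h2⟩ C D hC hD
    constructor
    · intro h s x hx
      obtain ⟨y, hy, hxy⟩ := (h2 C hC).1 s x hx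
      have hle : le2 (phi (P C)) D := by
        intro q hq
        choose f hf hf2 using fun s => h s (q s) ⟨q, hq, rfl⟩
        exact ⟨f, hf, hf2⟩
      obtain ⟨z, hz, hyz⟩ := (h1 _ D (ne _ (hP C hC)) hD).2 hle s y hy
      exact ⟨z, hz, hxy.trans hyz⟩
    · intro h s x hx
      obtain ⟨y, hy, hxy⟩ := (h2 D hD).2 s x hx
      have hle : le1 C (phi (G D)) := by
        intro q hq
        choose f hf hf2 using fun s => h s (q s) ⟨q, hq, rfl⟩
        exact ⟨f, hf, hf2⟩
      obtain ⟨z, hz, hyz⟩ := (h1 C _ hC (ne _ (hG D hD))).1 hle s y hy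
      exact ⟨z, hz, hyz.trans hxy⟩
end

section
/- Let A be an MLUB-complete bounded poset, (T,R) a time frame with R serial, and P, F, H, G the tense operators induced by (T,R). Then (P,G) and (F,H) form dynamic pairs, i.e.: (T0) G({𝟙})(s) = {1} and P({𝟘})(s) = {0} for all s ∈ T, where 𝟙, 𝟘 ∈ A^T are the constant functions with value 1, respectively 0, and analogously H({𝟙})(s) = {1} and F({𝟘})(s) = {0}; (T1) for all nonempty C, D ⊆ A^T, C ≤₁ D implies P(C) ≤₂ P(D) and F(C) ≤₂ F(D), and C ≤₂ D implies G(C) ≤₁ G(D) and H(C) ≤₁ H(D); (T2) for every nonempty C ⊆ A^T, C ≤₁ (G*P)(C), (P*G)(C) ≤₂ C, C ≤₁ (H*F)(C) and (F*H)(C) ≤₂ C (all relations between families T → 𝒫(A) and subsets of A^T taken pointwise). -/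
open Set

theorem aux_nonempty {α T : Type*} {Q : T → Prop} (hQ : ∃ t, Q t) {B : Set (T → α)}
    (hB : B.Nonempty) : ({x | ∃ q ∈ B, ∃ t, Q t ∧ x = q t} : Set α).Nonempty := by
  obtain ⟨t, ht⟩ := hQ
  obtain ⟨q, hq⟩ := hB
  exact ⟨q t, q, hq, t, ht, rfl⟩

theorem aux_max_top {α T : Type*} [PartialOrder α] [BoundedOrder α] (Q : T → Prop) :
    maxSet (lowerBounds {x | ∃ q ∈ ({fun _ => (⊤ : α)} : Set (T → α)), ∃ t, Q t ∧ x = q t})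
      = {(⊤ : α)} := by
  have ht : (⊤ : α) ∈ lowerBounds
      {x | ∃ q ∈ ({fun _ => (⊤ : α)} : Set (T → α)), ∃ t, Q t ∧ x = q t} := by
    rintro x ⟨q, rfl, t, _, rfl⟩
    exact le_rfl
  ext a
  constructor
  · rintro ⟨_, h2⟩
    exact h2 ⊤ ht le_top
  · rintro rfl
    exact ⟨ht, fun b _ hb => (top_le_iff.mp hb).symm⟩

theorem aux_min_bot {α T : Type*} [PartialOrder α] [BoundedOrder α] (Q : T → Prop) :
    minSet (upperBounds {x | ∃ q ∈ ({fun _ => (⊥ : α)} : Set (T → α)), ∃ t, Q t ∧ x = q t})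
      = {(⊥ : α)} := by
  have ht : (⊥ : α) ∈ upperBounds
      {x | ∃ q ∈ ({fun _ => (⊥ : α)} : Set (T → α)), ∃ t, Q t ∧ x = q t} := by
    rintro x ⟨q, rfl, t, _, rfl⟩
    exact le_rfl
  ext a
  constructor
  · rintro ⟨_, h2⟩
    exact h2 ⊥ ht bot_le
  · rintro rfl
    exact ⟨ht, fun b _ hb => (le_bot_iff.mp hb).symm⟩

theorem aux_mono_min {α T : Type*} [PartialOrder α] (h : MUBComplete α) {Q : T → Prop}
    (hQ : ∃ t, Q t) {C D : Set (T → α)} (hC : C.Nonempty) (hCD : le1 C D) :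
    le2 (minSet (upperBounds {x | ∃ q ∈ C, ∃ t, Q t ∧ x = q t}))
      (minSet (upperBounds {x | ∃ q ∈ D, ∃ t, Q t ∧ x = q t})) := by
  rintro y ⟨hy, _⟩
  refine h _ (aux_nonempty hQ hC) y ?_
  rintro x ⟨q, hq, t, ht, rfl⟩
  obtain ⟨d, hd, hqd⟩ := hCD q hq
  exact (hqd t).trans (hy ⟨d, hd, t, ht, rfl⟩)

theorem aux_mono_max {α T : Type*} [PartialOrder α] (h : MLBComplete α) {Q : T → Prop}
    (hQ : ∃ t, Q t) {C D : Set (T → α)} (hD : D.Nonempty) (hCD : le2 C D) :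
    le1 (maxSet (lowerBounds {x | ∃ q ∈ C, ∃ t, Q t ∧ x = q t}))
      (maxSet (lowerBounds {x | ∃ q ∈ D, ∃ t, Q t ∧ x = q t})) := by
  rintro y ⟨hy, _⟩
  refine h _ (aux_nonempty hQ hD) y ?_
  rintro x ⟨q, hq, t, ht, rfl⟩
  obtain ⟨d, hd, hqd⟩ := hCD q hq
  exact (hy ⟨d, hd, t, ht, rfl⟩).trans (hqd t)

theorem aux_phi {α T : Type*} {B : T → Set α} (hB : ∀ t, (B t).Nonempty) :
    (phi B).Nonempty := by
  choose f hf using hB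
  exact ⟨f, hf⟩

theorem aux_GP {α T : Type*} [PartialOrder α] [BoundedOrder α] (h : MLUBComplete α)
    (R : T → T → Prop) (hR : Serial R) (C : Set (T → α)) (hC : C.Nonempty) (s : T) :
    le1 (evalAt s C) (tG R (phi (tP R C)) s) := by
  rintro _ ⟨q, hq, rfl⟩
  refine h.2 _ (aux_nonempty (hR s).2 (aux_phi fun t => ?_)) _ ?_
  · obtain ⟨m, hm, _⟩ := h.1 _ (aux_nonempty (hR t).1 hC) ⊤ (fun _ _ => le_top)
    exact ⟨m, hm⟩
  · rintro _ ⟨p, hp, t, ht, rfl⟩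
    exact (hp t).1 ⟨q, hq, s, ht, rfl⟩

theorem aux_PG {α T : Type*} [PartialOrder α] [BoundedOrder α] (h : MLUBComplete α)
    (R : T → T → Prop) (hR : Serial R) (C : Set (T → α)) (hC : C.Nonempty) (s : T) :
    le2 (tP R (phi (tG R C)) s) (evalAt s C) := by
  rintro _ ⟨q, hq, rfl⟩
  refine h.1 _ (aux_nonempty (hR s).1 (aux_phi fun t => ?_)) _ ?_
  · obtain ⟨m, hm, _⟩ := h.2 _ (aux_nonempty (hR t).2 hC) ⊥ (fun _ _ => bot_le)
    exact ⟨m, hm⟩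
  · rintro _ ⟨p, hp, t, ht, rfl⟩
    exact (hp t).1 ⟨q, hq, s, ht, rfl⟩

/-- Theorem 3.19: with R serial, (P,G) and (F,H) form dynamic pairs,
i.e. they satisfy (T0), (T1) and (T2). -/
theorem stmt13 {α T : Type*} [PartialOrder α] [BoundedOrder α] [Nonempty T]
    (h : MLUBComplete α) (R : T → T → Prop) (hR : Serial R) :
    (∀ s : T,
      tG R ({fun _ => (⊤ : α)} : Set (T → α)) s = {(⊤ : α)} ∧
      tP R ({fun _ => (⊥ : α)} : Set (T → α)) s = {(⊥ : α)} ∧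
      tH R ({fun _ => (⊤ : α)} : Set (T → α)) s = {(⊤ : α)} ∧
      tF R ({fun _ => (⊥ : α)} : Set (T → α)) s = {(⊥ : α)}) ∧
    (∀ C D : Set (T → α), C.Nonempty → D.Nonempty →
      (le1 C D → ∀ s, le2 (tP R C s) (tP R D s) ∧ le2 (tF R C s) (tF R D s)) ∧
      (le2 C D → ∀ s, le1 (tG R C s) (tG R D s) ∧ le1 (tH R C s) (tH R D s))) ∧
    (∀ C : Set (T → α), C.Nonempty →
      (∀ s, le1 (evalAt s C) (tG R (phi (tP R C)) s)) ∧
      (∀ s, le2 (tP R (phi (tG R C)) s) (evalAt s C)) ∧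
      (∀ s, le1 (evalAt s C) (tH R (phi (tF R C)) s)) ∧
      (∀ s, le2 (tF R (phi (tH R C)) s) (evalAt s C))) := by
  have hR' : Serial (fun a b => R b a) := fun s => ⟨(hR s).2, (hR s).1⟩
  refine ⟨fun s => ⟨aux_max_top _, aux_min_bot _, aux_max_top _, aux_min_bot _⟩,
    fun C D hC hD => ⟨fun hCD s => ⟨aux_mono_min h.1 (hR s).1 hC hCD,
      aux_mono_min h.1 (hR s).2 hC hCD⟩, fun hCD s => ⟨aux_mono_max h.2 (hR s).2 hD hCD,
      aux_mono_max h.2 (hR s).1 hD hCD⟩⟩,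
    fun C hC => ⟨aux_GP h R hR C hC, aux_PG h R hR C hC,
      aux_GP h (fun a b => R b a) hR' C hC, aux_PG h (fun a b => R b a) hR' C hC⟩⟩
end

section
/- Let A be an MLUB-complete bounded poset, T a nonempty set, and P, F, H, G arbitrary maps sending each nonempty B ⊆ A^T to a family T → 𝒫(A). Define the induced relation R* on T by: s R* t if and only if for every nonempty B ⊆ A^T, H(B)(t) ≤ B(s) ≤ P(B)(t) and G(B)(s) ≤ B(t) ≤ F(B)(s), where B(s) = {q(s) : q ∈ B} and X ≤ Y means x ≤ y for all x ∈ X, y ∈ Y. Assume R* is serial, and let P*, F*, H*, G* be the tense operators induced by the time frame (T,R*). Then for every nonempty B ⊆ A^T and every s ∈ T: P*(B)(s) ≤₂ P(B)(s), F*(B)(s) ≤₂ F(B)(s), H(B)(s) ≤₁ H*(B)(s) and G(B)(s) ≤₁ G*(B)(s). -/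
open Set

/-- The relation R* induced by tense operators P, F, H, G:
s R* t iff H(B)(t) ≤ B(s) ≤ P(B)(t) and G(B)(s) ≤ B(t) ≤ F(B)(s)
for every nonempty B ⊆ A^T. -/
def indRel {α T : Type*} [PartialOrder α]
    (P F H G : Set (T → α) → T → Set α) : T → T → Prop := fun s t =>
  ∀ B : Set (T → α), B.Nonempty →
    leS (H B t) (evalAt s B) ∧ leS (evalAt s B) (P B t) ∧
    leS (G B s) (evalAt t B) ∧ leS (evalAt t B) (F B s)

/-- Theorem 5.2: the tense operators induced by (T,R*) are comparable
with the given ones. -/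
theorem stmt15 {α T : Type*} [PartialOrder α] [BoundedOrder α] [Nonempty T]
    (h : MLUBComplete α) (P F H G : Set (T → α) → T → Set α)
    (hser : Serial (indRel P F H G))
    (B : Set (T → α)) (hB : B.Nonempty) (s : T) :
    le2 (tP (indRel P F H G) B s) (P B s) ∧
    le2 (tF (indRel P F H G) B s) (F B s) ∧
    le1 (H B s) (tH (indRel P F H G) B s) ∧
    le1 (G B s) (tG (indRel P F H G) B s) := by
  obtain ⟨q₀, hq₀⟩ := hB
  obtain ⟨⟨r, hr⟩, ⟨u, hu⟩⟩ := hser s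
  refine ⟨?_, ?_, ?_, ?_⟩
  · intro y hy
    refine h.1 {x | ∃ q ∈ B, ∃ t, indRel P F H G t s ∧ x = q t} ⟨q₀ r, q₀, hq₀, r, hr, rfl⟩ y ?_
    rintro x ⟨q, hq, t, ht, rfl⟩
    exact (ht B ⟨q₀, hq₀⟩).2.1 _ ⟨q, hq, rfl⟩ y hy
  · intro y hy
    refine h.1 {x | ∃ q ∈ B, ∃ t, indRel P F H G s t ∧ x = q t} ⟨q₀ u, q₀, hq₀, u, hu, rfl⟩ y ?_
    rintro x ⟨q, hq, t, ht, rfl⟩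
    exact (ht B ⟨q₀, hq₀⟩).2.2.2 _ ⟨q, hq, rfl⟩ y hy
  · intro y hy
    refine h.2 {x | ∃ q ∈ B, ∃ t, indRel P F H G t s ∧ x = q t} ⟨q₀ r, q₀, hq₀, r, hr, rfl⟩ y ?_
    rintro x ⟨q, hq, t, ht, rfl⟩
    exact (ht B ⟨q₀, hq₀⟩).1 y hy _ ⟨q, hq, rfl⟩
  · intro y hy
    refine h.2 {x | ∃ q ∈ B, ∃ t, indRel P F H G s t ∧ x = q t} ⟨q₀ u, q₀, hq₀, u, hu, rfl⟩ y ?_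
    rintro x ⟨q, hq, t, ht, rfl⟩
    exact (ht B ⟨q₀, hq₀⟩).2.2.1 y hy _ ⟨q, hq, rfl⟩
end

section
/- Let A be an MLUB-complete bounded poset, (T,R) a time frame with R serial, and P, F, H, G the tense operators induced by (T,R). Let R* be the relation induced by P, F, H, G (i.e. s R* t iff for every nonempty B ⊆ A^T, H(B)(t) ≤ B(s) ≤ P(B)(t) and G(B)(s) ≤ B(t) ≤ F(B)(s)), and let P*, F*, H*, G* be the tense operators induced by the time frame (T,R*). Then R ⊆ R* and P* = P, F* = F, H* = H and G* = G (as maps on nonempty subsets of A^T). -/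
open Set

/-- Theorem 5.4: if P, F, H, G are induced by a serial time frame (T,R),
then R ⊆ R* and the operators induced by (T,R*) coincide with them. -/
theorem stmt16 {α T : Type*} [PartialOrder α] [BoundedOrder α] [Nonempty T]
    (h : MLUBComplete α) (R : T → T → Prop) (hR : Serial R) :
    (∀ s t, R s t → indRel (α := α) (tP R) (tF R) (tH R) (tG R) s t) ∧
    (∀ B : Set (T → α), B.Nonempty →
      tP (indRel (α := α) (tP R) (tF R) (tH R) (tG R)) B = tP R B ∧
      tF (indRel (α := α) (tP R) (tF R) (tH R) (tG R)) B = tF R B ∧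
      tH (indRel (α := α) (tP R) (tF R) (tH R) (tG R)) B = tH R B ∧
      tG (indRel (α := α) (tP R) (tF R) (tH R) (tG R)) B = tG R B) := by
  have hsub : ∀ s t, R s t → indRel (α := α) (tP R) (tF R) (tH R) (tG R) s t := by
    intro s t hst B hB
    refine ⟨?_, ?_, ?_, ?_⟩
    · rintro x hx _ ⟨q, hq, rfl⟩
      exact hx.1 ⟨q, hq, s, hst, rfl⟩
    · rintro _ ⟨q, hq, rfl⟩ x hx
      exact hx.1 ⟨q, hq, s, hst, rfl⟩
    · rintro x hx _ ⟨q, hq, rfl⟩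
      exact hx.1 ⟨q, hq, t, hst, rfl⟩
    · rintro _ ⟨q, hq, rfl⟩ x hx
      exact hx.1 ⟨q, hq, t, hst, rfl⟩
  refine ⟨hsub, fun B hB => ?_⟩
  obtain ⟨q0, hq0⟩ := hB
  refine ⟨?_, ?_, ?_, ?_⟩
  · funext s
    refine congrArg minSet (Set.Subset.antisymm ?_ ?_)
    · rintro x hx _ ⟨q, hq, t, ht, rfl⟩
      exact hx ⟨q, hq, t, hsub _ _ ht, rfl⟩
    · rintro x hx _ ⟨q, hq, t, ht, rfl⟩
      obtain ⟨r, hr⟩ := (hR s).1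
      obtain ⟨m, hm, hmx⟩ := h.1 _ (by exact ⟨q0 r, q0, hq0, r, hr, rfl⟩) x hx
      exact ((ht B ⟨q0, hq0⟩).2.1 _ ⟨q, hq, rfl⟩ m hm).trans hmx
  · funext s
    refine congrArg minSet (Set.Subset.antisymm ?_ ?_)
    · rintro x hx _ ⟨q, hq, t, ht, rfl⟩
      exact hx ⟨q, hq, t, hsub _ _ ht, rfl⟩
    · rintro x hx _ ⟨q, hq, t, ht, rfl⟩
      obtain ⟨r, hr⟩ := (hR s).2
      obtain ⟨m, hm, hmx⟩ := h.1 _ (by exact ⟨q0 r, q0, hq0, r, hr, rfl⟩) x hx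
      exact ((ht B ⟨q0, hq0⟩).2.2.2 _ ⟨q, hq, rfl⟩ m hm).trans hmx
  · funext s
    refine congrArg maxSet (Set.Subset.antisymm ?_ ?_)
    · rintro x hx _ ⟨q, hq, t, ht, rfl⟩
      exact hx ⟨q, hq, t, hsub _ _ ht, rfl⟩
    · rintro x hx _ ⟨q, hq, t, ht, rfl⟩
      obtain ⟨r, hr⟩ := (hR s).1
      obtain ⟨m, hm, hmx⟩ := h.2 _ (by exact ⟨q0 r, q0, hq0, r, hr, rfl⟩) x hx
      exact hmx.trans ((ht B ⟨q0, hq0⟩).1 m hm _ ⟨q, hq, rfl⟩)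
  · funext s
    refine congrArg maxSet (Set.Subset.antisymm ?_ ?_)
    · rintro x hx _ ⟨q, hq, t, ht, rfl⟩
      exact hx ⟨q, hq, t, hsub _ _ ht, rfl⟩
    · rintro x hx _ ⟨q, hq, t, ht, rfl⟩
      obtain ⟨r, hr⟩ := (hR s).2
      obtain ⟨m, hm, hmx⟩ := h.2 _ (by exact ⟨q0 r, q0, hq0, r, hr, rfl⟩) x hx
      exact hmx.trans ((ht B ⟨q0, hq0⟩).2.2.1 m hm _ ⟨q, hq, rfl⟩)
end

section
/- Let A be a bounded poset satisfying both the ACC and the DCC. For x, y ∈ A set x⊙y = Max L({x,y}); for S ⊆ A and z ∈ A write S ≤ z when s ≤ z for all s ∈ S; and set x→y = Max{z ∈ A : x⊙z ≤ y}. Then for all x, y, z, w ∈ A: (1) x⊙y = y⊙x and 1⊙x = {x}; (2) if x ≤ z and y ≤ w then x⊙y ≤₁ z⊙w; (3) (adjointness) x⊙y ≤ z if and only if there exists u ∈ y→z with x ≤ u (equivalently, x⊙y ≤₁ {z} iff {x} ≤₁ y→z); (4) for every u ∈ x→y and every v ∈ u⊙x, v ≤ y (i.e. (x→y)⊙x ≤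 y). -/
open Set

/-- The "unsharp" conjunction: x ⊙ y = Max L({x,y}). -/
def odot {α : Type*} [PartialOrder α] (x y : α) : Set α :=
  maxSet (lowerBounds {x, y})

/-- The "unsharp" implication: x → y = Max {z : x ⊙ z ≤ y}. -/
def implS {α : Type*} [PartialOrder α] (x y : α) : Set α :=
  maxSet {z | ∀ v ∈ odot x z, v ≤ y}

/-- Extension of ⊙ to subsets: B ⊙ C = Max LU(⋃ {b ⊙ c : b ∈ B, c ∈ C}). -/
def odotS {α : Type*} [PartialOrder α] (B C : Set α) : Set α :=
  maxSet (lowerBounds (upperBounds (⋃ b ∈ B, ⋃ c ∈ C, odot b c)))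

theorem exists_maxSet_ge {α : Type*} [PartialOrder α] [WellFoundedGT α] (X : Set α) (a : α)
    (ha : a ∈ X) : ∃ m ∈ maxSet X, a ≤ m := by
  induction a using WellFoundedGT.induction with
  | ind a ih =>
    by_cases h : ∃ b ∈ X, a < b
    · obtain ⟨b, hb, hab⟩ := h
      obtain ⟨m, hm, hbm⟩ := ih b hab hb
      exact ⟨m, hm, hab.le.trans hbm⟩
    · refine ⟨a, ⟨ha, fun b hb hab => ?_⟩, le_rfl⟩
      by_contra hne
      exact h ⟨b, hb, lt_of_le_of_ne hab hne⟩

theorem odot_le_iff {α : Type*} [PartialOrder α] [WellFoundedGT α] (x y z : α) :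
    (∀ v ∈ odot x y, v ≤ z) ↔ ∀ v, v ≤ x → v ≤ y → v ≤ z := by
  constructor
  · intro h v hx hy
    obtain ⟨m, hm, hvm⟩ := exists_maxSet_ge (lowerBounds {x, y}) v (by simp [hx, hy])
    exact hvm.trans (h m hm)
  · intro h v hv
    exact h v (hv.1 (by simp)) (hv.1 (by simp))

/-- Lemma 6.2: properties of ⊙ and → on elements of a bounded poset
with ACC and DCC. -/
theorem stmt17 {α : Type*} [PartialOrder α] [BoundedOrder α]
    [WellFoundedGT α] [WellFoundedLT α] (x y z w : α) :
    (odot x y = odot y x ∧ odot (⊤ : α) x = {x}) ∧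
    (x ≤ z → y ≤ w → le1 (odot x y) (odot z w)) ∧
    ((∀ v ∈ odot x y, v ≤ z) ↔ ∃ u ∈ implS y z, x ≤ u) ∧
    (∀ u ∈ implS x y, ∀ v ∈ odot u x, v ≤ y) := by
  refine ⟨⟨?_, ?_⟩, ?_, ?_, ?_⟩
  · unfold odot
    rw [Set.pair_comm]
  · ext a
    simp only [odot, maxSet, Set.mem_setOf_eq, Set.mem_singleton_iff]
    constructor
    · rintro ⟨h1, h2⟩
      exact h2 x (by simp) (h1 (by simp))
    · rintro rfl
      exact ⟨by simp, fun b hb hab => le_antisymm hab (hb (by simp))⟩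
  · intro hxz hyw v hv
    have h1 : v ≤ x := hv.1 (by simp)
    have h2 : v ≤ y := hv.1 (by simp)
    exact exists_maxSet_ge (lowerBounds {z, w}) v (by simp [h1.trans hxz, h2.trans hyw])
  · rw [odot_le_iff]
    constructor
    · intro h
      exact exists_maxSet_ge {t | ∀ v ∈ odot y t, v ≤ z} x
        ((odot_le_iff y x z).2 fun v hy hx => h v hx hy)
    · rintro ⟨u, hu, hxu⟩ v hx hy
      exact (odot_le_iff y u z).1 hu.1 v hy (hx.trans hxu)
  · intro u hu v hv
    exact (odot_le_iff x u y).1 hu.1 v (hv.1 (by simp)) (hv.1 (by simp))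
end

section
/- Let A be a bounded poset satisfying both the ACC and the DCC, and let B, C, D, E be nonempty subsets of A. For x, y ∈ A set x⊙y = Max L({x,y}), and for nonempty B, C ⊆ A set B⊙C = Max LU(⋃{b⊙c : b ∈ B, c ∈ C}). Then: (1) B⊙C = C⊙B and {1}⊙B = Max LU(B); (2) if D ≤₁ B and D ≤₁ C then D ≤₁ B⊙C; (3) B⊙C ≤ Min U(B) (all-pairs ≤) and B⊙C ≤₁ Max LU(B); (4) B⊙B = Max LU(B); (5) if B ≤₁ D and C ≤₁ E then B⊙C ≤₁ D⊙E. -/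
open Set

theorem exists_le_maxSet {α : Type*} [PartialOrder α] [WellFoundedGT α] (X : Set α) (x : α)
    (hx : x ∈ X) : ∃ m ∈ maxSet X, x ≤ m := by
  induction x using WellFoundedGT.induction with
  | _ x ih =>
    by_cases h : ∀ b ∈ X, x ≤ b → x = b
    · exact ⟨x, ⟨hx, h⟩, le_rfl⟩
    · push Not at h
      obtain ⟨b, hb, hxb, hne⟩ := h
      obtain ⟨m, hm, hbm⟩ := ih b (lt_of_le_of_ne hxb hne) hb
      exact ⟨m, hm, hxb.trans hbm⟩

theorem mem_ub_odot {α : Type*} [PartialOrder α] [WellFoundedGT α] (B C : Set α) (u : α) :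
    u ∈ upperBounds (⋃ b ∈ B, ⋃ c ∈ C, odot b c) ↔
      ∀ b ∈ B, ∀ c ∈ C, ∀ x, x ≤ b → x ≤ c → x ≤ u := by
  constructor
  · intro h b hb c hc x hxb hxc
    obtain ⟨m, hm, hxm⟩ := exists_le_maxSet (lowerBounds {b, c}) x (by
      rintro y (rfl | rfl) <;> assumption)
    refine hxm.trans (h ?_)
    simp only [mem_iUnion]
    exact ⟨b, hb, c, hc, hm⟩
  · intro h x hx
    simp only [mem_iUnion] at hx
    obtain ⟨b, hb, c, hc, hm⟩ := hx
    exact h b hb c hc x (hm.1 (by simp)) (hm.1 (by simp))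

/-- Lemma 6.3: properties of the extended operation ⊙ on nonempty subsets. -/
theorem stmt18 {α : Type*} [PartialOrder α] [BoundedOrder α]
    [WellFoundedGT α] [WellFoundedLT α]
    (B C D E : Set α) (hB : B.Nonempty) (hC : C.Nonempty)
    (hD : D.Nonempty) (hE : E.Nonempty) :
    (odotS B C = odotS C B ∧
      odotS {(⊤ : α)} B = maxSet (lowerBounds (upperBounds B))) ∧
    (le1 D B → le1 D C → le1 D (odotS B C)) ∧
    (leS (odotS B C) (minSet (upperBounds B)) ∧
      le1 (odotS B C) (maxSet (lowerBounds (upperBounds B)))) ∧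
    odotS B B = maxSet (lowerBounds (upperBounds B)) ∧
    (le1 B D → le1 C E → le1 (odotS B C) (odotS D E)) := by
  have e1 : odotS {(⊤ : α)} B = maxSet (lowerBounds (upperBounds B)) := by
    unfold odotS
    congr 2
    ext u
    rw [mem_ub_odot]
    constructor
    · intro h b hb
      exact h ⊤ rfl b hb b le_top le_rfl
    · intro h a _ b hb x _ hxb
      exact hxb.trans (h hb)
  have e2 : odotS B B = maxSet (lowerBounds (upperBounds B)) := by
    unfold odotS
    congr 2
    ext u
    rw [mem_ub_odot]
    constructor
    · intro h b hb
      exact h b hb b hb b le_rfl le_rfl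
    · intro h a _ b hb x _ hxb
      exact hxb.trans (h hb)
  refine ⟨⟨?_, e1⟩, ?_, ⟨?_, ?_⟩, e2, ?_⟩
  · unfold odotS
    congr 2
    ext u
    rw [mem_ub_odot, mem_ub_odot]
    exact ⟨fun h c hc b hb x h1 h2 => h b hb c hc x h2 h1,
      fun h c hc b hb x h1 h2 => h b hb c hc x h2 h1⟩
  · intro h1 h2 d hd
    apply exists_le_maxSet
    intro u hu
    rw [mem_ub_odot] at hu
    obtain ⟨b, hb, hdb⟩ := h1 d hd
    obtain ⟨c, hc, hdc⟩ := h2 d hd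
    exact hu b hb c hc d hdb hdc
  · intro x hx y hy
    apply hx.1
    rw [mem_ub_odot]
    intro b hb c _ z hz _
    exact hz.trans (hy.1 hb)
  · intro x hx
    apply exists_le_maxSet
    intro y hy
    apply hx.1
    rw [mem_ub_odot]
    intro b hb c _ z hz _
    exact hz.trans (hy hb)
  · intro h1 h2 x hx
    apply exists_le_maxSet
    intro u hu
    apply hx.1
    rw [mem_ub_odot] at hu ⊢
    intro b hb c hc z hzb hzc
    obtain ⟨d, hd, hbd⟩ := h1 b hb
    obtain ⟨e, he, hce⟩ := h2 c hc
    exact hu d hd e he z (hzb.trans hbd) (hzc.trans hce)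
end
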